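/- arXiv:2206.12970 — 2 statements merged into one kernel-verified Lean document; each statement's English description precedes it below -/
import Mathlib

section
/- Every optimal checking sequence π* satisfies π* ⊆ Π(i_max); that is, every instruction (i,j) occurring in an optimal checking sequence has password index i ≤ i_max. -/
noncomputable section

/-- Parameters of the cost-asymmetric memory-hard password hashing model:
`n` passwords with probabilities `p 1 >= ... >= p n`, `m` breakpoints with
probabilities `q 1, ..., q m`, running-time breakpoints `t 0 < t 1 < ... < t m`,
memory-cost constant `cM` and password value `v`. -/
structure Params where
  n : ℕ
  m : ℕ
  p : ℕ → ℝ
  q : ℕ → ℝ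
  t : ℕ → ℝ
  cM : ℝ
  v : ℝ

namespace Params

/-- The standing hypotheses on the parameters. -/
structure Hyp (P : Params) : Prop where
  hn : 1 ≤ P.n
  hm : 1 ≤ P.m
  p_pos : ∀ i ∈ Finset.Icc 1 P.n, 0 < P.p i
  p_anti : ∀ i ∈ Finset.Icc 1 P.n, ∀ i' ∈ Finset.Icc 1 P.n, i ≤ i' → P.p i' ≤ P.p i
  p_sum : ∑ i ∈ Finset.Icc 1 P.n, P.p i ≤ 1
  q_nonneg : ∀ j ∈ Finset.Icc 1 P.m, 0 ≤ P.q j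
  q_sum : ∑ j ∈ Finset.Icc 1 P.m, P.q j = 1
  t_zero : P.t 0 = 0
  t_mono : ∀ j j', j < j' → j' ≤ P.m → P.t j < P.t j'
  cM_pos : 0 < P.cM
  v_pos : 0 < P.v

/-- Cumulative breakpoint probability `Q j = q 1 + ... + q j`. -/
def Q (P : Params) (j : ℕ) : ℝ := ∑ j' ∈ Finset.Icc 1 j, P.q j'

/-- Round cost `c(i, j) = cM * (t j ^ 2 - t (j-1) ^ 2)` of executing an
instruction with label index `j` (it does not depend on the password index). -/
def rc (P : Params) (j : ℕ) : ℝ := P.cM * (P.t j ^ 2 - P.t (j - 1) ^ 2)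

/-- A checking sequence is determined by its exponent vector `τ`: for each
password `i ∈ [1, n]` the attacker executes the instructions
`(i, 1), ..., (i, τ i)`, passwords being processed in increasing order.
`τ` is valid if `τ i ≤ m` for all `i` and `τ i = 0` outside `[1, n]`. -/
def Valid (P : Params) (τ : ℕ → ℕ) : Prop :=
  (∀ i, τ i ≤ P.m) ∧ ∀ i, i ∉ Finset.Icc 1 P.n → τ i = 0

/-- Success probability `λ(π)` of the checking sequence with exponent vector `τ`. -/
def lam (P : Params) (τ : ℕ → ℕ) : ℝ := ∑ i ∈ Finset.Icc 1 P.n, P.p i * P.Q (τ i)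

/-- Probability mass `λ(π, k-1)` of the instructions strictly preceding the
instruction `(i, j)` in the checking sequence with exponent vector `τ`. -/
def lamBefore (P : Params) (τ : ℕ → ℕ) (i j : ℕ) : ℝ :=
  (∑ i' ∈ Finset.Ico 1 i, P.p i' * P.Q (τ i')) + P.p i * P.Q (j - 1)

/-- Attacker's utility `U(π) = v·λ(π) - Σ_k c(π_k)·(1 - λ(π, k-1))`. -/
def U (P : Params) (τ : ℕ → ℕ) : ℝ :=
  P.v * P.lam τ -
    ∑ i ∈ Finset.Icc 1 P.n, ∑ j ∈ Finset.Icc 1 (τ i), P.rc j * (1 - P.lamBefore τ i j)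

/-- A checking sequence is optimal if it maximizes the attacker's utility. -/
def Optimal (P : Params) (τ : ℕ → ℕ) : Prop :=
  P.Valid τ ∧ ∀ τ', P.Valid τ' → P.U τ' ≤ P.U τ

/-- `π ⊆ π'` for checking sequences: `τ i ≤ τ' i` for all `i`. -/
def Subseq (P : Params) (τ τ' : ℕ → ℕ) : Prop := ∀ i, τ i ≤ τ' i

/-- `Π(l)`: the checking sequence fully checking the top `l` passwords
(`τ i = m` for `i ≤ l` and `τ i = 0` for `i > l`). -/
def Pifull (P : Params) (l : ℕ) : ℕ → ℕ := fun i => if 1 ≤ i ∧ i ≤ l then P.m else 0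

/-- `F i`: the best marginal utility of appending a block `ϖ_i(1, j)`,
`1 ≤ j ≤ m`, to `Π(i - 1)`. -/
def F (P : Params) (i : ℕ) : ℝ :=
  sSup ((fun j => P.U (Function.update (P.Pifull (i - 1)) i j) - P.U (P.Pifull (i - 1))) ''
    Set.Icc 1 P.m)

/-- `i_max`: the largest `i ∈ [1, n]` with `F i ≥ 0`, or `0` if there is none. -/
def imax (P : Params) : ℕ := sSup {i | i ∈ Finset.Icc 1 P.n ∧ 0 ≤ P.F i}

theorem Q_mono {P : Params} (hP : P.Hyp) {a b : ℕ} (hab : a ≤ b) (hb : b ≤ P.m) :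
    P.Q a ≤ P.Q b := by
  apply Finset.sum_le_sum_of_subset_of_nonneg (Finset.Icc_subset_Icc_right hab)
  intro j hj _
  exact hP.q_nonneg j (Finset.Icc_subset_Icc_right hb hj)

theorem rc_nonneg {P : Params} (hP : P.Hyp) {j : ℕ} (hj : j ∈ Finset.Icc 1 P.m) :
    0 ≤ P.rc j := by
  rw [Finset.mem_Icc] at hj
  have h₁ : P.t (j - 1) < P.t j := hP.t_mono _ _ (by omega) hj.2
  have h₀ : 0 ≤ P.t (j - 1) := by
    rcases Nat.eq_zero_or_pos (j - 1) with h | h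
    · rw [h, hP.t_zero]
    · have := hP.t_mono 0 (j - 1) h (by omega)
      rw [hP.t_zero] at this
      exact this.le
  exact mul_nonneg hP.cM_pos.le (by nlinarith)

/-- Marginal utility of appending the block `ϖ_l(1, j)` to a checking sequence all of whose
instructions have password index less than `l`. -/
theorem U_update_sub (P : Params) {σ : ℕ → ℕ} {l : ℕ} (hl : l ∈ Finset.Icc 1 P.n)
    (hσ : ∀ i, l ≤ i → σ i = 0) (j : ℕ) :
    P.U (Function.update σ l j) - P.U σ = P.v * (P.p l * P.Q j) -
      ∑ k ∈ Finset.Icc 1 j, P.rc k *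
        (1 - ((∑ i ∈ Finset.Ico 1 l, P.p i * P.Q (σ i)) + P.p l * P.Q (k - 1))) := by
  have hprefix : ∀ i ≤ l, ∑ i' ∈ Finset.Ico 1 i, P.p i' * P.Q (Function.update σ l j i') =
      ∑ i' ∈ Finset.Ico 1 i, P.p i' * P.Q (σ i') := by
    intro i hi
    refine Finset.sum_congr rfl fun i' hi' => ?_
    rw [Finset.mem_Ico] at hi'
    rw [Function.update_of_ne (by omega)]
  have hlam : P.lam (Function.update σ l j) - P.lam σ = P.p l * P.Q j := by
    unfold lam
    rw [← Finset.sum_sub_distrib, Finset.sum_eq_single_of_mem l hl]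
    · simp [hσ l le_rfl, Q]
    · intro i _ hi
      rw [Function.update_of_ne hi, sub_self]
  have hcost : (∑ i ∈ Finset.Icc 1 P.n, ∑ k ∈ Finset.Icc 1 (Function.update σ l j i),
        P.rc k * (1 - P.lamBefore (Function.update σ l j) i k)) -
      ∑ i ∈ Finset.Icc 1 P.n, ∑ k ∈ Finset.Icc 1 (σ i), P.rc k * (1 - P.lamBefore σ i k) =
      ∑ k ∈ Finset.Icc 1 j, P.rc k *
        (1 - ((∑ i ∈ Finset.Ico 1 l, P.p i * P.Q (σ i)) + P.p l * P.Q (k - 1))) := by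
    rw [← Finset.sum_sub_distrib, Finset.sum_eq_single_of_mem l hl]
    · simp [hσ l le_rfl, lamBefore, hprefix l le_rfl]
    · intro i _ hi
      rw [Function.update_of_ne hi]
      rcases lt_or_gt_of_ne hi with h | h
      · simp only [lamBefore, hprefix i h.le, sub_self]
      · simp [hσ i h.le]
  unfold U
  rw [← hlam, ← hcost]
  ring

/-- The marginal utility of appending a block grows with the checking sequence it is appended
to, so it is largest for `Π(l - 1)`. -/
theorem U_update_sub_le_Pifull {P : Params} (hP : P.Hyp) {σ : ℕ → ℕ} {l j : ℕ}
    (hl : l ∈ Finset.Icc 1 P.n) (hσ : ∀ i, l ≤ i → σ i = 0) (hσm : ∀ i, σ i ≤ P.m)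
    (hj : j ≤ P.m) :
    P.U (Function.update σ l j) - P.U σ ≤
      P.U (Function.update (P.Pifull (l - 1)) l j) - P.U (P.Pifull (l - 1)) := by
  have hl' := Finset.mem_Icc.1 hl
  have hfull : ∀ i, l ≤ i → P.Pifull (l - 1) i = 0 := fun i hi => if_neg (by omega)
  rw [U_update_sub P hl hσ, U_update_sub P hl hfull]
  refine sub_le_sub_left (Finset.sum_le_sum fun k hk => ?_) _
  refine mul_le_mul_of_nonneg_left ?_ (rc_nonneg hP (Finset.Icc_subset_Icc_right hj hk))
  refine sub_le_sub_left (add_le_add_left (Finset.sum_le_sum fun i hi => ?_) _) _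
  rw [Finset.mem_Ico] at hi
  rw [show P.Pifull (l - 1) i = P.m from if_pos (by omega)]
  exact mul_le_mul_of_nonneg_left (Q_mono hP (hσm i) le_rfl)
    (hP.p_pos i (Finset.mem_Icc.2 (by omega))).le

/-- every optimal checking sequence is contained in `Π(i_max)`,
i.e. it contains no instruction with password index larger than `i_max`. -/
theorem statement3 (P : Params) (hP : P.Hyp) (τ : ℕ → ℕ) (hopt : P.Optimal τ) :
    P.Subseq τ (P.Pifull P.imax) := by
  obtain ⟨⟨hm, hsupp⟩, hmax⟩ := hopt
  intro i
  rcases Nat.eq_zero_or_pos (τ i) with hi0 | hi0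
  · omega
  have hin : i ∈ Finset.Icc 1 P.n := by
    by_contra h
    exact hi0.ne' (hsupp i h)
  obtain ⟨l, hlS, hlmax⟩ := Finset.exists_max_image
    ((Finset.Icc 1 P.n).filter fun i => 0 < τ i) id ⟨i, Finset.mem_filter.2 ⟨hin, hi0⟩⟩
  obtain ⟨hl, hl0⟩ := Finset.mem_filter.1 hlS
  set σ := Function.update τ l 0 with hσdef
  have hσ : ∀ i, l ≤ i → σ i = 0 := by
    intro k hk
    rcases eq_or_lt_of_le hk with rfl | hk
    · simp [hσdef]
    · rw [hσdef, Function.update_of_ne hk.ne']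
      by_contra h
      by_cases hkn : k ∈ Finset.Icc 1 P.n
      · exact absurd (hlmax k (Finset.mem_filter.2 ⟨hkn, Nat.pos_of_ne_zero h⟩)) (not_le.2 hk)
      · exact h (hsupp k hkn)
  have hστ : ∀ i, σ i ≤ τ i := by
    intro k
    rcases eq_or_ne k l with rfl | hk
    · simp [hσdef]
    · rw [hσdef, Function.update_of_ne hk]
  have hσm : ∀ i, σ i ≤ P.m := fun k => (hστ k).trans (hm k)
  have hUσ : P.U σ ≤ P.U τ :=
    hmax σ ⟨hσm, fun k hk => Nat.le_zero.1 ((hστ k).trans (hsupp k hk).le)⟩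
  have hle := U_update_sub_le_Pifull hP hl hσ hσm (hm l)
  rw [show Function.update σ l (τ l) = τ by simp [hσdef]] at hle
  have hF : 0 ≤ P.F l := by
    refine (sub_nonneg.2 hUσ).trans (hle.trans ?_)
    exact le_csSup ((Set.finite_Icc 1 P.m).image _).bddAbove ⟨τ l, ⟨hl0, hm l⟩, rfl⟩
  have hlimax : l ≤ P.imax :=
    le_csSup ⟨P.n, fun k hk => (Finset.mem_Icc.1 hk.1).2⟩ ⟨hl, hF⟩
  have hil : i ≤ l := hlmax i (Finset.mem_filter.2 ⟨hin, hi0⟩)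
  rw [show P.Pifull P.imax i = P.m from
    if_pos ⟨(Finset.mem_Icc.1 hin).1, hil.trans hlimax⟩]
  exact hm i

end Params
end
end

section
/- Assume cost-even breakpoints (t_j² = j·t_1²) and uniform breakpoint probabilities q_j = 1/m, and set C_max := c_M·t_1²·(m+1)/2 (the expected cost of one full evaluation). Then every optimal checking sequence π* satisfies λ(π*) ≤ P_adv^d, where P_adv^d is the success rate of a rational attacker under deterministic hashing with per-password cost C_max. -/
noncomputable section

namespace Params

/-- Success rate `Λ_b` of checking the top `b` passwords. -/
def LamD (P : Params) (b : ℕ) : ℝ := ∑ i ∈ Finset.Icc 1 b, P.p i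

/-- Attacker's utility under deterministic hashing with per-password cost `Cmax`
when checking the top `b` passwords. -/
def Ud (P : Params) (Cmax : ℝ) (b : ℕ) : ℝ :=
  P.v * P.LamD b - Cmax * ∑ i ∈ Finset.Icc 1 b, (1 - P.LamD (i - 1))

/-- Contribution of password `i` to the attacker's utility. -/
def gain (P : Params) (τ : ℕ → ℕ) (i : ℕ) : ℝ :=
  P.v * (P.p i * P.Q (τ i)) - ∑ j ∈ Finset.Icc 1 (τ i), P.rc j * (1 - P.lamBefore τ i j)

/-- Success probability accumulated strictly before password `i`. -/
def lamPrior (P : Params) (τ : ℕ → ℕ) (i : ℕ) : ℝ :=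
  ∑ i' ∈ Finset.Ico 1 i, P.p i' * P.Q (τ i')

/-- Number of passwords among the first `i` that are checked at all. -/
def checkedCount (τ : ℕ → ℕ) (i : ℕ) : ℕ :=
  ∑ i' ∈ Finset.Icc 1 i, if τ i' = 0 then 0 else 1

lemma U_eq_sum_gain (P : Params) (τ : ℕ → ℕ) :
    P.U τ = ∑ i ∈ Finset.Icc 1 P.n, P.gain τ i := by
  simp only [U, lam, gain, Finset.sum_sub_distrib, Finset.mul_sum]

lemma Q_eq_div (P : Params) (huni : ∀ j ∈ Finset.Icc 1 P.m, P.q j = 1 / (P.m : ℝ))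
    {a : ℕ} (ha : a ≤ P.m) : P.Q a = a / P.m := by
  have h : ∀ j ∈ Finset.Icc 1 a, P.q j = 1 / (P.m : ℝ) := fun j hj => by
    rw [Finset.mem_Icc] at hj
    exact huni j (Finset.mem_Icc.2 ⟨hj.1, hj.2.trans ha⟩)
  rw [Q, Finset.sum_congr rfl h]
  simp [div_eq_mul_inv]

lemma rc_eq_const (P : Params) (hP : P.Hyp)
    (hce : ∀ j ∈ Finset.Icc 1 P.m, P.t j ^ 2 = (j : ℝ) * P.t 1 ^ 2)
    {j : ℕ} (hj1 : 1 ≤ j) (hjm : j ≤ P.m) : P.rc j = P.cM * P.t 1 ^ 2 := by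
  obtain ⟨k, rfl⟩ : ∃ k, j = k + 1 := ⟨j - 1, by omega⟩
  have h1 := hce (k + 1) (Finset.mem_Icc.2 ⟨hj1, hjm⟩)
  have h2 : P.t k ^ 2 = (k : ℝ) * P.t 1 ^ 2 := by
    rcases Nat.eq_zero_or_pos k with rfl | hk
    · simp [hP.t_zero]
    · exact hce k (Finset.mem_Icc.2 ⟨hk, by omega⟩)
  rw [rc, Nat.add_sub_cancel, h1, h2]
  push_cast
  ring

lemma gain_eq (P : Params) (hP : P.Hyp)
    (hce : ∀ j ∈ Finset.Icc 1 P.m, P.t j ^ 2 = (j : ℝ) * P.t 1 ^ 2)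
    (huni : ∀ j ∈ Finset.Icc 1 P.m, P.q j = 1 / (P.m : ℝ))
    {τ : ℕ → ℕ} {i : ℕ} (hτ : τ i ≤ P.m) :
    P.gain τ i = P.v * (P.p i * (τ i / P.m)) -
      P.cM * P.t 1 ^ 2 * (τ i * (1 - P.lamPrior τ i) - P.p i * (τ i * (τ i - 1)) / (2 * P.m)) := by
  have hcost : ∀ a ≤ P.m, ∑ j ∈ Finset.Icc 1 a, P.rc j * (1 - P.lamBefore τ i j) =
      P.cM * P.t 1 ^ 2 * (a * (1 - P.lamPrior τ i) - P.p i * (a * (a - 1)) / (2 * P.m)) := by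
    intro a
    induction a with
    | zero => simp
    | succ a ih =>
      intro ha
      have hm : (P.m : ℝ) ≠ 0 := Nat.cast_ne_zero.2 (by omega)
      rw [Finset.sum_Icc_succ_top (by omega), ih (by omega), P.rc_eq_const hP hce (by omega) ha,
        lamBefore, Nat.add_sub_cancel, P.Q_eq_div huni (by omega), ← lamPrior]
      push_cast
      field_simp
      ring
  rw [gain, hcost _ hτ, P.Q_eq_div huni hτ]

lemma cost_pos (P : Params) (hP : P.Hyp) : 0 < P.cM * P.t 1 ^ 2 := by
  have h := hP.t_mono 0 1 one_pos hP.hm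
  rw [hP.t_zero] at h
  exact mul_pos hP.cM_pos (pow_pos h 2)

lemma Valid.update {P : Params} {τ : ℕ → ℕ} (hτ : P.Valid τ) {i a : ℕ}
    (hi : i ∈ Finset.Icc 1 P.n) (ha : a ≤ P.m) : P.Valid (Function.update τ i a) := by
  refine ⟨fun k => ?_, fun k hk => ?_⟩
  · rcases eq_or_ne k i with rfl | h
    · simpa using ha
    · simpa [h] using hτ.1 k
  · have h : k ≠ i := fun h => hk (h ▸ hi)
    simpa [h] using hτ.2 k hk

/-- The utility is strictly convex in each exponent, so optimal exponents are extreme. -/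
lemma Optimal.eq_zero_or_eq_m {P : Params} (hP : P.Hyp)
    (hce : ∀ j ∈ Finset.Icc 1 P.m, P.t j ^ 2 = (j : ℝ) * P.t 1 ^ 2)
    (huni : ∀ j ∈ Finset.Icc 1 P.m, P.q j = 1 / (P.m : ℝ))
    {τ : ℕ → ℕ} (hopt : P.Optimal τ) {i : ℕ} (hi : i ∈ Finset.Icc 1 P.n) :
    τ i = 0 ∨ τ i = P.m := by
  by_contra! hne
  have hv := hopt.1
  have hv0 := hv.update hi (Nat.zero_le P.m)
  have hvm := hv.update hi le_rfl
  have h0 := hopt.2 _ hv0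
  have h1 := hopt.2 _ hvm
  set τ0 := Function.update τ i 0 with hτ0
  set τm := Function.update τ i P.m with hτm
  have hc := P.cost_pos hP
  have hm : (0 : ℝ) < P.m := Nat.cast_pos.2 hP.hm
  have ha0 : (0 : ℝ) < τ i := Nat.cast_pos.2 (Nat.pos_of_ne_zero hne.1)
  have ham : (τ i : ℝ) < P.m := Nat.cast_lt.2 (lt_of_le_of_ne (hv.1 i) hne.2)
  have hpre : ∀ k, P.m * P.lamPrior τ k =
      (P.m - τ i) * P.lamPrior τ0 k + τ i * P.lamPrior τm k := by
    intro k
    simp only [lamPrior, Finset.mul_sum, ← Finset.sum_add_distrib]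
    refine Finset.sum_congr rfl fun l _ => ?_
    rw [P.Q_eq_div huni (hv.1 l), P.Q_eq_div huni (hv0.1 l), P.Q_eq_div huni (hvm.1 l)]
    rcases eq_or_ne l i with rfl | h
    · simp only [hτ0, hτm, Function.update_self, Nat.cast_zero]
      field_simp
      ring
    · simp only [hτ0, hτm, Function.update_of_ne h]
      ring
  have hpre_same : ∀ a, P.lamPrior (Function.update τ i a) i = P.lamPrior τ i := by
    intro a
    refine Finset.sum_congr rfl fun l hl => ?_
    rw [Function.update_of_ne (Finset.mem_Ico.1 hl).2.ne]
  have hother : ∀ k, k ≠ i → P.m * P.gain τ k =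
      (P.m - τ i) * P.gain τ0 k + τ i * P.gain τm k := by
    intro k hk
    rw [P.gain_eq hP hce huni (hv.1 k), P.gain_eq hP hce huni (hv0.1 k),
      P.gain_eq hP hce huni (hvm.1 k)]
    have e0 : τ0 k = τ k := Function.update_of_ne hk _ _
    have em : τm k = τ k := Function.update_of_ne hk _ _
    rw [e0, em]
    linear_combination (P.cM * P.t 1 ^ 2 * τ k) * hpre k
  have hself : P.m * P.gain τ i < (P.m - τ i) * P.gain τ0 i + τ i * P.gain τm i := by
    rw [P.gain_eq hP hce huni (hv.1 i), P.gain_eq hP hce huni (hv0.1 i),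
      P.gain_eq hP hce huni (hvm.1 i), hτ0, hτm, hpre_same, hpre_same]
    simp only [Function.update_self, Nat.cast_zero]
    have hpos : 0 < P.cM * P.t 1 ^ 2 * P.p i * τ i * (P.m - τ i) / 2 := by
      have := hP.p_pos i hi
      have := sub_pos.2 ham
      positivity
    rw [← sub_pos]
    convert hpos using 1
    field_simp
    ring
  have hlt : P.m * P.U τ < (P.m - τ i) * P.U τ0 + τ i * P.U τm := by
    simp only [U_eq_sum_gain, Finset.mul_sum, ← Finset.sum_add_distrib]
    refine Finset.sum_lt_sum (fun k _ => ?_) ⟨i, hi, hself⟩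
    rcases eq_or_ne k i with rfl | h
    · exact hself.le
    · exact (hother k h).le
  nlinarith [mul_le_mul_of_nonneg_left h0 (sub_pos.2 ham).le, mul_le_mul_of_nonneg_left h1 ha0.le]

/-- Truncating an optimal checking sequence after password `l` does not help. -/
lemma Optimal.sum_gain_le {P : Params} {τ : ℕ → ℕ} (hopt : P.Optimal τ) {l : ℕ} (hl : l ≤ P.n) :
    ∑ i ∈ Finset.Icc 1 l, P.gain τ i ≤ ∑ i ∈ Finset.Icc 1 P.n, P.gain τ i := by
  set σ : ℕ → ℕ := fun i => if i ≤ l then τ i else 0 with hσ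
  have hvalid : P.Valid σ := by
    refine ⟨fun i => ?_, fun i hi => ?_⟩
    · have := hopt.1.1 i
      simp only [hσ]
      split_ifs <;> omega
    · simp [hσ, hopt.1.2 i hi]
  have h := hopt.2 σ hvalid
  rw [U_eq_sum_gain, U_eq_sum_gain] at h
  refine le_of_eq_of_le ?_ h
  rw [← Finset.sum_subset (Finset.Icc_subset_Icc_right hl) (f := P.gain σ)]
  · refine Finset.sum_congr rfl fun i hi => ?_
    have hil := (Finset.mem_Icc.1 hi).2
    have hpre : ∀ j, P.lamBefore σ i j = P.lamBefore τ i j := by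
      intro j
      rw [lamBefore, lamBefore]
      congr 1
      refine Finset.sum_congr rfl fun k hk => ?_
      have hk' : k ≤ l := by have := Finset.mem_Ico.1 hk; omega
      simp [hσ, hk']
    simp only [gain, hpre]
    simp [hσ, hil]
  · intro i hi hil
    have hil' : ¬ i ≤ l := fun h => hil (Finset.mem_Icc.2 ⟨(Finset.mem_Icc.1 hi).1, h⟩)
    simp [gain, hσ, hil', Q]

lemma checkedCount_succ (τ : ℕ → ℕ) (i : ℕ) :
    checkedCount τ (i + 1) = checkedCount τ i + if τ (i + 1) = 0 then 0 else 1 :=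
  Finset.sum_Icc_succ_top (by omega) _

lemma checkedCount_le (τ : ℕ → ℕ) (i : ℕ) : checkedCount τ i ≤ i := by
  induction i with
  | zero => simp [checkedCount]
  | succ i ih => rw [checkedCount_succ]; split_ifs <;> omega

lemma exists_checkedCount_eq (τ : ℕ → ℕ) (i : ℕ) :
    ∀ b ≤ checkedCount τ i, ∃ l ≤ i, checkedCount τ l = b := by
  induction i with
  | zero => exact fun b hb => ⟨0, le_rfl, by simp_all [checkedCount]⟩
  | succ i ih =>
    intro b hb
    by_cases h : b ≤ checkedCount τ i
    · obtain ⟨l, hl, e⟩ := ih b h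
      exact ⟨l, by omega, e⟩
    · refine ⟨i + 1, le_rfl, ?_⟩
      rw [checkedCount_succ] at hb ⊢
      split_ifs at hb ⊢ <;> omega

lemma LamD_succ (P : Params) (b : ℕ) : P.LamD (b + 1) = P.LamD b + P.p (b + 1) :=
  Finset.sum_Icc_succ_top (by omega) _

lemma Ud_succ (P : Params) (C : ℝ) (b : ℕ) :
    P.Ud C (b + 1) = P.Ud C b + (P.v * P.p (b + 1) - C * (1 - P.LamD b)) := by
  rw [Ud, Ud, LamD_succ, Finset.sum_Icc_succ_top (by omega), Nat.add_sub_cancel]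
  ring

lemma LamD_mono (P : Params) (hP : P.Hyp) {b b' : ℕ} (h : b ≤ b') (hb' : b' ≤ P.n) :
    P.LamD b ≤ P.LamD b' := by
  refine Finset.sum_le_sum_of_subset_of_nonneg (Finset.Icc_subset_Icc_right h) fun i hi _ => ?_
  exact (hP.p_pos i (Finset.Icc_subset_Icc_right hb' hi)).le

lemma LamD_le_one (P : Params) (hP : P.Hyp) {b : ℕ} (hb : b ≤ P.n) : P.LamD b ≤ 1 :=
  (P.LamD_mono hP hb le_rfl).trans hP.p_sum

lemma lamPrior_le_LamD (P : Params) (hP : P.Hyp)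
    (huni : ∀ j ∈ Finset.Icc 1 P.m, P.q j = 1 / (P.m : ℝ))
    {τ : ℕ → ℕ} (hτ : P.Valid τ) {i : ℕ} (hi : i ≤ P.n) :
    P.lamPrior τ (i + 1) ≤ P.LamD (checkedCount τ i) := by
  induction i with
  | zero => simp [lamPrior, checkedCount, LamD]
  | succ i ih =>
    have ih := ih (by omega)
    rw [lamPrior, Finset.sum_Ico_succ_top (by omega), ← lamPrior, checkedCount_succ]
    split_ifs with h
    · simpa [h, Q] using ih
    · rw [LamD_succ]
      have hle := checkedCount_le τ i
      have hp := hP.p_anti (checkedCount τ i + 1) (Finset.mem_Icc.2 (by omega)) (i + 1)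
        (Finset.mem_Icc.2 (by omega)) (by omega)
      have hpos := hP.p_pos (i + 1) (Finset.mem_Icc.2 (by omega))
      have hQ : P.Q (τ (i + 1)) ≤ 1 := by
        rw [P.Q_eq_div huni (hτ.1 _)]
        exact div_le_one_of_le₀ (Nat.cast_le.2 (hτ.1 _)) (Nat.cast_nonneg _)
      have := mul_le_of_le_one_right hpos.le hQ
      linarith

lemma gain_le_Ud_sub (P : Params) (hP : P.Hyp)
    (hce : ∀ j ∈ Finset.Icc 1 P.m, P.t j ^ 2 = (j : ℝ) * P.t 1 ^ 2)
    (huni : ∀ j ∈ Finset.Icc 1 P.m, P.q j = 1 / (P.m : ℝ))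
    {τ : ℕ → ℕ} (hτ : P.Valid τ) {i : ℕ} (hi : i + 1 ≤ P.n)
    (hext : τ (i + 1) = 0 ∨ τ (i + 1) = P.m) :
    P.gain τ (i + 1) ≤
      P.Ud (P.cM * P.t 1 ^ 2 * ((P.m : ℝ) + 1) / 2) (checkedCount τ (i + 1)) -
        P.Ud (P.cM * P.t 1 ^ 2 * ((P.m : ℝ) + 1) / 2) (checkedCount τ i) := by
  have hm1 := hP.hm
  rcases hext with h | h
  · simp [checkedCount_succ, h, gain, Q]
  · rw [checkedCount_succ, h, if_neg (by omega), Ud_succ, P.gain_eq hP hce huni (hτ.1 _), h]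
    have hle := checkedCount_le τ i
    have hp := hP.p_anti (checkedCount τ i + 1) (Finset.mem_Icc.2 (by omega)) (i + 1)
      (Finset.mem_Icc.2 (by omega)) (by omega)
    have hS := P.lamPrior_le_LamD hP huni hτ (i := i) (by omega)
    have hL := P.LamD_le_one hP (b := checkedCount τ i + 1) (by omega)
    rw [LamD_succ] at hL
    have hc := P.cost_pos hP
    have hv := hP.v_pos
    have hm : (1 : ℝ) ≤ P.m := Nat.one_le_cast.2 hm1
    generalize P.cM * P.t 1 ^ 2 = c at *
    generalize P.lamPrior τ (i + 1) = S at *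
    generalize P.LamD (checkedCount τ i) = L at *
    generalize P.p (checkedCount τ i + 1) = p' at *
    generalize P.p (i + 1) = p at *
    have e : p * (P.m * ((P.m : ℝ) - 1)) / (2 * P.m) = p * (P.m - 1) / 2 := by
      field_simp
    rw [e, div_self (by positivity)]
    have hvp : 0 ≤ P.v * (p' - p) := mul_nonneg hv.le (sub_nonneg.2 hp)
    have hSL : 0 ≤ c * P.m * (L - S) := mul_nonneg (by positivity) (sub_nonneg.2 hS)
    have hpL : 0 ≤ c * (P.m - 1) / 2 * (1 - L - p) :=
      mul_nonneg (div_nonneg (mul_nonneg hc.le (by linarith)) (by norm_num)) (by linarith)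
    linarith

/-- with cost-even breakpoints and uniform breakpoint
probabilities, the success rate of an optimal checking sequence is at most the
success rate `P_adv^d` of a rational attacker under deterministic hashing with
per-password cost `C_max = cM·t₁²·(m+1)/2`. -/
theorem statement9 (P : Params) (hP : P.Hyp)
    (hce : ∀ j ∈ Finset.Icc 1 P.m, P.t j ^ 2 = (j : ℝ) * P.t 1 ^ 2)
    (huni : ∀ j ∈ Finset.Icc 1 P.m, P.q j = 1 / (P.m : ℝ))
    (τ : ℕ → ℕ) (hopt : P.Optimal τ) :
    P.lam τ ≤
      sSup {x : ℝ | ∃ b ≤ P.n,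
        (∀ b' ≤ P.n, P.Ud (P.cM * P.t 1 ^ 2 * ((P.m : ℝ) + 1) / 2) b' ≤
            P.Ud (P.cM * P.t 1 ^ 2 * ((P.m : ℝ) + 1) / 2) b) ∧
          x = P.LamD b} := by
  set C := P.cM * P.t 1 ^ 2 * ((P.m : ℝ) + 1) / 2
  set k := checkedCount τ P.n
  have hkn : k ≤ P.n := checkedCount_le τ P.n
  have hmono : ∀ l i, l ≤ i → i ≤ P.n →
      P.Ud C (checkedCount τ l) - ∑ i' ∈ Finset.Icc 1 l, P.gain τ i' ≤
        P.Ud C (checkedCount τ i) - ∑ i' ∈ Finset.Icc 1 i, P.gain τ i' := by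
    intro l i hli
    induction i, hli using Nat.le_induction with
    | base => exact fun _ => le_rfl
    | succ i _ ih =>
      intro hi
      rw [Finset.sum_Icc_succ_top (by omega)]
      have := P.gain_le_Ud_sub hP hce huni hopt.1 hi
        (hopt.eq_zero_or_eq_m hP hce huni (Finset.mem_Icc.2 (by omega)))
      have := ih (by omega)
      linarith
  have hUd : ∀ b ≤ k, P.Ud C b ≤ P.Ud C k := by
    intro b hb
    obtain ⟨l, hl, rfl⟩ := exists_checkedCount_eq τ P.n b hb
    have := hmono l P.n hl le_rfl
    have := hopt.sum_gain_le hl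
    linarith
  have hlam : P.lam τ ≤ P.LamD k := P.lamPrior_le_LamD hP huni hopt.1 le_rfl
  obtain ⟨b, hb, hbmax⟩ := Finset.exists_max_image (Finset.range (P.n + 1)) (P.Ud C) ⟨0, by simp⟩
  simp only [Finset.mem_range, Nat.lt_succ_iff] at hb hbmax
  obtain ⟨b₀, hkb, hb₀, hmax⟩ : ∃ b₀, k ≤ b₀ ∧ b₀ ≤ P.n ∧ ∀ b' ≤ P.n, P.Ud C b' ≤ P.Ud C b₀ := by
    rcases le_total k b with h | h
    · exact ⟨b, h, hb, hbmax⟩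
    · exact ⟨k, le_rfl, hkn, fun b' hb' => (hbmax b' hb').trans (hUd b h)⟩
  refine hlam.trans ((P.LamD_mono hP hkb hb₀).trans (le_csSup ⟨1, ?_⟩ ⟨b₀, hb₀, hmax, rfl⟩))
  rintro x ⟨b', hb', -, rfl⟩
  exact P.LamD_le_one hP hb'

end Params
end
end
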